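/- Let n, m ∈ ℕ with 1 ≤ m ≤ n, and let e : {1,…,n} → ℝ satisfy 0 ≤ e_i ≤ 1 for all i. Set r = m/n and ē = (1/n) Σ_{i=1}^{n} e_i, and assume 0 < ē ≤ r. Define λ = e^{r−ē} · (ē/r)^r (where e denotes Euler's number). Then ε_E(n,m) ≤ λ^n. -/

import Mathlib

/-- Poisson binomial probability: the probability that exactly `k` of the
classifiers indexed by `S` make an error, where classifier `i` errs with
probability `e i`. -/
noncomputable def pE (S : Finset ℕ) (e : ℕ → ℝ) (k : ℕ) : ℝ :=
  ∑ A ∈ S.powerset.filter (fun A => A.card = k),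
    (∏ i ∈ A, e i) * ∏ j ∈ S \ A, (1 - e j)

/-- Poisson binomial tail probability: at least `m` errors among the
classifiers indexed by `{1, …, n}`. -/
noncomputable def epsE (n : ℕ) (e : ℕ → ℝ) (m : ℕ) : ℝ :=
  ∑ k ∈ Finset.Icc m n, pE (Finset.Icc 1 n) e k

/-- The probability generating function of the Poisson binomial distribution. -/
theorem sum_pow_mul_pE (S : Finset ℕ) (e : ℕ → ℝ) (t : ℝ) :
    ∑ k ∈ Finset.range (S.card + 1), t ^ k * pE S e k = ∏ i ∈ S, (t * e i + (1 - e i)) := by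
  rw [Finset.prod_add, ← Finset.sum_fiberwise_of_maps_to (g := Finset.card)
    (t := Finset.range (S.card + 1))]
  · refine Finset.sum_congr rfl fun k _ => ?_
    rw [pE, Finset.mul_sum]
    refine Finset.sum_congr rfl fun A hA => ?_
    rw [Finset.prod_mul_distrib, Finset.prod_const, (Finset.mem_filter.mp hA).2, mul_assoc]
  · intro A hA
    exact Finset.mem_range_succ_iff.mpr (Finset.card_le_card (Finset.mem_powerset.mp hA))

theorem pE_nonneg {S : Finset ℕ} {e : ℕ → ℝ} (he : ∀ i ∈ S, 0 ≤ e i ∧ e i ≤ 1) (k : ℕ) :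
    0 ≤ pE S e k := by
  refine Finset.sum_nonneg fun A hA => ?_
  have hAS : A ⊆ S := Finset.mem_powerset.mp (Finset.mem_filter.mp hA).1
  exact mul_nonneg (Finset.prod_nonneg fun i hi => (he i (hAS hi)).1)
    (Finset.prod_nonneg fun i hi => sub_nonneg.mpr (he i (Finset.mem_sdiff.mp hi).1).2)

/-- The Chernoff bound for the tail of the Poisson binomial distribution. -/
theorem pow_mul_epsE_le_exp {n : ℕ} {e : ℕ → ℝ}
    (he : ∀ i ∈ Finset.Icc 1 n, 0 ≤ e i ∧ e i ≤ 1) (m : ℕ) {t : ℝ} (ht : 1 ≤ t) :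
    t ^ m * epsE n e m ≤ Real.exp ((t - 1) * ∑ i ∈ Finset.Icc 1 n, e i) := by
  have ht0 : 0 ≤ t := zero_le_one.trans ht
  calc t ^ m * epsE n e m
      ≤ ∑ k ∈ Finset.Icc m n, t ^ k * pE (Finset.Icc 1 n) e k := by
        rw [epsE, Finset.mul_sum]
        refine Finset.sum_le_sum fun k hk => ?_
        exact mul_le_mul_of_nonneg_right (pow_le_pow_right₀ ht (Finset.mem_Icc.mp hk).1)
          (pE_nonneg he k)
    _ ≤ ∑ k ∈ Finset.range ((Finset.Icc 1 n).card + 1), t ^ k * pE (Finset.Icc 1 n) e k := by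
        refine Finset.sum_le_sum_of_subset_of_nonneg (fun k hk => ?_) fun k _ _ =>
          mul_nonneg (pow_nonneg ht0 k) (pE_nonneg he k)
        simpa [Nat.lt_succ_iff] using (Finset.mem_Icc.mp hk).2
    _ = ∏ i ∈ Finset.Icc 1 n, (t * e i + (1 - e i)) := sum_pow_mul_pE _ e t
    _ ≤ ∏ i ∈ Finset.Icc 1 n, Real.exp ((t - 1) * e i) := by
        refine Finset.prod_le_prod (fun i hi => ?_) fun i _ => ?_
        · exact add_nonneg (mul_nonneg ht0 (he i hi).1) (sub_nonneg.mpr (he i hi).2)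
        · linarith [Real.add_one_le_exp ((t - 1) * e i)]
    _ = Real.exp ((t - 1) * ∑ i ∈ Finset.Icc 1 n, e i) := by
        rw [← Real.exp_sum, Finset.mul_sum]

theorem stmt8 (n m : ℕ) (hm1 : 1 ≤ m) (hmn : m ≤ n)
    (e : ℕ → ℝ) (he : ∀ i ∈ Finset.Icc 1 n, 0 ≤ e i ∧ e i ≤ 1)
    (r ebar : ℝ) (hr : r = (m : ℝ) / n)
    (hbar : ebar = (1 / (n : ℝ)) * ∑ i ∈ Finset.Icc 1 n, e i)
    (h0 : 0 < ebar) (hbr : ebar ≤ r)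
    (lam : ℝ) (hlam : lam = Real.exp (r - ebar) * (ebar / r) ^ r) :
    epsE n e m ≤ lam ^ n := by
  have hn : (0 : ℝ) < n := by exact_mod_cast hm1.trans hmn
  have hr0 : 0 < r := h0.trans_le hbr
  have hsum : ∑ i ∈ Finset.Icc 1 n, e i = n * ebar := by
    rw [hbar]; field_simp
  have hrn : r * n = m := by
    rw [hr]; field_simp
  have hchernoff := pow_mul_epsE_le_exp he m ((one_le_div h0).mpr hbr)
  have hexp : (r / ebar - 1) * ∑ i ∈ Finset.Icc 1 n, e i = n * (r - ebar) := by
    rw [hsum]; field_simp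
  have hlamn : lam ^ n = Real.exp (n * (r - ebar)) / (r / ebar) ^ m := by
    rw [hlam, mul_pow, ← Real.exp_nat_mul, ← Real.rpow_mul_natCast (div_pos h0 hr0).le, hrn,
      Real.rpow_natCast, ← inv_div r ebar, inv_pow, ← div_eq_mul_inv]
  rw [hexp] at hchernoff
  rwa [hlamn, le_div_iff₀' (pow_pos (div_pos hr0 h0) m)]
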